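/- Let S be a finite set with |S| = κ ≥ 2. For ℓ ≥ 0 set H_N(ℓ) = {η ∈ H_N : η_x ≤ N − ℓ for all x ∈ S}, and for a > 0 set ℓ_N^{(a)} = N/(log N)^a. Then for every a > 0 there exists a constant C = C(κ,a) > 0 such that, for all sufficiently large N, (N/(log N)^{κ−1}) Σ_{η∈H_N(ℓ_N^{(a)})} 1/a(η) ≤ C (log log N)/(log N). -/

import Mathlib

open Filter

namespace ZRP

variable (S : Type) [Fintype S] [DecidableEq S]

/-- Configurations of `n` particles on the finite set `S`. -/
def Conf (n : ℕ) : Type := {η : S → ℕ // ∑ x, η x = n}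

instance (n : ℕ) : DecidableEq (Conf S n) := fun a b =>
  decidable_of_iff (a.1 = b.1) Subtype.ext_iff.symm

noncomputable instance (n : ℕ) : Fintype (Conf S n) :=
  Fintype.ofInjective
    (fun η (x : S) => (⟨η.1 x, Nat.lt_succ_of_le (by
        calc η.1 x ≤ ∑ z, η.1 z :=
              Finset.single_le_sum (fun i _ => Nat.zero_le _) (Finset.mem_univ x)
          _ = n := η.2)⟩ : Fin (n + 1)))
    (fun η ζ h => Subtype.ext (funext fun x => congrArg Fin.val (congrFun h x)))

variable {S}

/-- `a(η) = ∏_x max(η_x, 1)`. -/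
noncomputable def aconf (η : S → ℕ) : ℝ := ∏ x, ((max (η x) 1 : ℕ) : ℝ)


/-- The one-site weight `1 / max(k, 1)`. -/
noncomputable def siteWeight (k : ℕ) : ℝ := 1 / ((max k 1 : ℕ) : ℝ)

theorem siteWeight_pos (k : ℕ) : 0 < siteWeight k := by
  unfold siteWeight
  positivity

theorem one_div_aconf {S : Type} [Fintype S] (η : S → ℕ) :
    1 / aconf η = ∏ x, siteWeight (η x) := by
  simp [aconf, siteWeight, Finset.prod_inv_distrib]

theorem sum_Icc_inv_le_log {m n : ℕ} (hm : 1 ≤ m) (hmn : m ≤ n) :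
    ∑ k ∈ Finset.Icc m n, (1 : ℝ) / k ≤ 1 + Real.log (n / m) := by
  have hm' : (1 : ℝ) ≤ m := by exact_mod_cast hm
  induction n, hmn using Nat.le_induction with
  | base =>
    rw [div_self (by positivity)]
    simpa using inv_le_one_of_one_le₀ hm'
  | succ n hmn ih =>
    have hn : (0 : ℝ) < n := by
      have : (m : ℝ) ≤ n := by exact_mod_cast hmn
      linarith
    rw [Finset.sum_Icc_succ_top (by omega)]
    have h1 := Real.one_sub_inv_le_log_of_pos (x := ((n : ℝ) + 1) / n) (by positivity)
    have h2 : 1 - (((n : ℝ) + 1) / n)⁻¹ = 1 / ((n : ℝ) + 1) := by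
      field_simp
      ring
    rw [Real.log_div (by positivity) (by positivity)] at h1 ih ⊢
    push_cast
    linarith

theorem sum_siteWeight_le {n : ℕ} (hn : 1 ≤ n) :
    ∑ k ∈ Finset.range (n + 1), siteWeight k ≤ 2 + Real.log n := by
  have h := sum_Icc_inv_le_log le_rfl hn
  have h2 : ∑ k ∈ Finset.range (n + 1), siteWeight k
      = 1 + ∑ k ∈ Finset.Icc 1 n, (1 : ℝ) / k := by
    rw [Finset.range_eq_Ico, Finset.sum_eq_sum_Ico_succ_bot (by omega)]
    congr 1
    · simp [siteWeight]
    · refine Finset.sum_congr (by ext; simp) fun k hk => ?_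
      rw [siteWeight, max_eq_left (Finset.mem_Icc.1 hk).1]
  rw [Nat.cast_one, div_one] at h
  linarith

theorem sum_siteWeight_tail_le {n : ℕ} {t : ℝ} (ht : 0 < t) (htn : t ≤ n) :
    ∑ k ∈ Finset.range (n + 1), (if t ≤ (k : ℝ) then siteWeight k else 0)
      ≤ 1 + Real.log (n / t) := by
  have hm : 1 ≤ ⌈t⌉₊ := Nat.one_le_ceil_iff.2 ht
  have hmn : ⌈t⌉₊ ≤ n := Nat.ceil_le.2 htn
  have hle : t ≤ (⌈t⌉₊ : ℝ) := Nat.le_ceil t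
  calc _ = ∑ k ∈ Finset.Icc ⌈t⌉₊ n, (1 : ℝ) / k := by
        rw [← Finset.sum_filter]
        refine Finset.sum_congr ?_ fun k hk => ?_
        · ext k
          simp only [Finset.mem_filter, Finset.mem_range, Finset.mem_Icc, Nat.ceil_le]
          rw [Nat.lt_succ_iff, and_comm]
        · rw [siteWeight, max_eq_left (hm.trans (Finset.mem_Icc.1 hk).1)]
    _ ≤ 1 + Real.log (n / ⌈t⌉₊) := sum_Icc_inv_le_log hm hmn
    _ ≤ _ := by
        have hn : (0 : ℝ) < n := ht.trans_le htn
        have hc : (0 : ℝ) < ⌈t⌉₊ := ht.trans_le hle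
        gcongr

/-- A configuration is determined by its occupation numbers away from one site, so a sum of
products over the other sites factorises up to an inequality. -/
theorem sum_conf_prod_le {S : Type} [Fintype S] [DecidableEq S] (N : ℕ) (x : S)
    (g : S → ℕ → ℝ) (hg : ∀ z k, 0 ≤ g z k) :
    ∑ η : Conf S N, ∏ z ∈ Finset.univ.erase x, g z (η.1 z)
      ≤ ∏ z ∈ Finset.univ.erase x, ∑ k ∈ Finset.range (N + 1), g z k := by
  rw [Finset.prod_sum]
  let F : Conf S N → ((z : S) → z ∈ Finset.univ.erase x → ℕ) := fun η z _ => η.1 z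
  have hF : Function.Injective F := by
    intro η ζ h
    have hne : ∀ z ∈ Finset.univ.erase x, η.1 z = ζ.1 z := fun z hz =>
      congrFun (congrFun h z) hz
    have hη := Finset.add_sum_erase Finset.univ (fun z => η.1 z) (Finset.mem_univ x)
    have hζ := Finset.add_sum_erase Finset.univ (fun z => ζ.1 z) (Finset.mem_univ x)
    rw [η.2] at hη
    have hrest : ∑ z ∈ Finset.univ.erase x, η.1 z = ∑ z ∈ Finset.univ.erase x, ζ.1 z :=
      Finset.sum_congr rfl hne
    rw [ζ.2] at hζ
    refine Subtype.ext (funext fun z => ?_)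
    by_cases hz : z = x
    · subst hz
      omega
    · exact hne z (by simp [hz])
  calc _ = ∑ η : Conf S N, ∏ z ∈ (Finset.univ.erase x).attach, g z.1 (F η z.1 z.2) :=
        Finset.sum_congr rfl fun η _ =>
          (Finset.prod_attach (Finset.univ.erase x) fun z => g z (η.1 z)).symm
    _ = ∑ p ∈ Finset.univ.image F, ∏ z ∈ (Finset.univ.erase x).attach, g z.1 (p z.1 z.2) :=
        (Finset.sum_image (f := fun p => ∏ z ∈ (Finset.univ.erase x).attach, g z.1 (p z.1 z.2))
          fun η _ ζ _ h => hF h).symm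
    _ ≤ _ := by
        refine Finset.sum_le_sum_of_subset_of_nonneg ?_ fun p _ _ =>
          Finset.prod_nonneg fun z _ => hg _ _
        intro p hp
        obtain ⟨η, -, rfl⟩ := Finset.mem_image.1 hp
        refine Finset.mem_pi.2 fun z _ => Finset.mem_range.2 (Nat.lt_succ_of_le ?_)
        calc η.1 z ≤ ∑ y, η.1 y :=
              Finset.single_le_sum (fun i _ => Nat.zero_le _) (Finset.mem_univ z)
          _ = N := η.2

/-- If every occupation number is at most `N - l`, then some site carries at least `N / κ`
particles and another one at least `l / κ`. -/
theorem exists_two_large {S : Type} [Fintype S] [DecidableEq S] (hcard : 0 < Fintype.card S)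
    {N : ℕ} {l : ℝ} (hl : 0 < l) (η : Conf S N) (h : ∀ x, (η.1 x : ℝ) ≤ N - l) :
    ∃ x, ∃ y ∈ Finset.univ.erase x,
      (N : ℝ) / Fintype.card S ≤ η.1 x ∧ l / Fintype.card S ≤ η.1 y := by
  have hκ : (0 : ℝ) < Fintype.card S := by exact_mod_cast hcard
  have hsum : ∑ x, (η.1 x : ℝ) = N := by exact_mod_cast η.2
  have : Nonempty S := Fintype.card_pos_iff.1 hcard
  obtain ⟨x, -, hx⟩ := Finset.exists_le_of_sum_le (s := Finset.univ)
    (f := fun _ : S => (N : ℝ) / Fintype.card S) (g := fun x => (η.1 x : ℝ))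
    Finset.univ_nonempty (by
      rw [hsum, Finset.sum_const, Finset.card_univ, nsmul_eq_mul, mul_div_cancel₀ _ hκ.ne'])
  refine ⟨x, ?_⟩
  by_contra! hy
  have hy' : ∀ y ∈ Finset.univ.erase x, (η.1 y : ℝ) ≤ l / Fintype.card S :=
    fun y hyx => (hy y hyx hx).le
  have h1 := Finset.sum_le_sum hy'
  have h2 := Finset.add_sum_erase Finset.univ (fun x => (η.1 x : ℝ)) (Finset.mem_univ x)
  rw [Finset.sum_const, Finset.card_erase_of_mem (Finset.mem_univ x), Finset.card_univ,
    nsmul_eq_mul, Nat.cast_sub hcard] at h1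
  have h3 : ((Fintype.card S : ℝ) - (1 : ℕ)) * (l / Fintype.card S) < l := by
    rw [mul_div_assoc', div_lt_iff₀ hκ]
    push_cast
    nlinarith
  have h4 := h x
  linarith

theorem sum_conf_indicator_le {S : Type} [Fintype S] [DecidableEq S]
    (hcard : 2 ≤ Fintype.card S) {N : ℕ} (hN : 1 ≤ N) {l : ℝ} (hl : 0 < l) (hlN : l ≤ N) :
    ∑ η : Conf S N,
        Set.indicator {η : Conf S N | ∀ x, (η.1 x : ℝ) ≤ (N : ℝ) - l}
          (fun η => 1 / aconf η.1) η
      ≤ (Fintype.card S : ℝ) ^ 2 * ((Fintype.card S : ℝ) / N *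
          ((1 + Real.log (N / (l / Fintype.card S))) *
            (2 + Real.log N) ^ (Fintype.card S - 2))) := by
  set κ := Fintype.card S with hκdef
  have hκ : (1 : ℝ) ≤ κ := by exact_mod_cast (by omega : 1 ≤ κ)
  have hNpos : (0 : ℝ) < N := by exact_mod_cast hN
  set t : ℝ := l / κ with ht
  have htpos : 0 < t := by positivity
  have htN : t ≤ N := (div_le_self hl.le hκ).trans hlN
  let g : S → S → ℕ → ℝ := fun y z k =>
    if z = y then (if t ≤ (k : ℝ) then siteWeight k else 0) else siteWeight k
  have hg : ∀ y z k, 0 ≤ g y z k := by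
    intro y z k
    have := (siteWeight_pos k).le
    dsimp only [g]
    split_ifs <;> simp [this]
  let P : S → S → Conf S N → ℝ := fun x y η => ∏ z ∈ Finset.univ.erase x, g y z (η.1 z)
  have hP : ∀ x y η, 0 ≤ P x y η := fun x y η => Finset.prod_nonneg fun z _ => hg _ _ _
  have hpoint : ∀ η : Conf S N,
      Set.indicator {η : Conf S N | ∀ x, (η.1 x : ℝ) ≤ (N : ℝ) - l}
          (fun η => 1 / aconf η.1) η
        ≤ ∑ x, ∑ y ∈ Finset.univ.erase x, (κ : ℝ) / N * P x y η := by
    intro η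
    have hterm : ∀ x y, 0 ≤ (κ : ℝ) / N * P x y η := fun x y =>
      mul_nonneg (by positivity) (hP x y η)
    refine Set.indicator_apply_le' (fun hη => ?_) fun _ =>
      Finset.sum_nonneg fun x _ => Finset.sum_nonneg fun y _ => hterm x y
    obtain ⟨x, y, hy, hx1, hy1⟩ := exists_two_large (by omega) hl η hη
    calc 1 / aconf η.1 = siteWeight (η.1 x) * ∏ z ∈ Finset.univ.erase x, siteWeight (η.1 z) := by
          rw [one_div_aconf, Finset.mul_prod_erase _ (fun z => siteWeight (η.1 z))
            (Finset.mem_univ x)]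
      _ = siteWeight (η.1 x) * P x y η := by
          congr 1
          refine Finset.prod_congr rfl fun z _ => ?_
          dsimp only [g]
          split_ifs with h1 h2
          · rfl
          · subst h1
            exact absurd hy1 h2
          · rfl
      _ ≤ (κ : ℝ) / N * P x y η := by
          refine mul_le_mul_of_nonneg_right ?_ (hP x y η)
          have hmax : (N : ℝ) / κ ≤ ((max (η.1 x) 1 : ℕ) : ℝ) :=
            hx1.trans (by exact_mod_cast le_max_left _ _)
          calc siteWeight (η.1 x) ≤ 1 / ((N : ℝ) / κ) :=
                one_div_le_one_div_of_le (by positivity) hmax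
            _ = (κ : ℝ) / N := one_div_div _ _
      _ ≤ ∑ y ∈ Finset.univ.erase x, (κ : ℝ) / N * P x y η :=
          Finset.single_le_sum (f := fun y => (κ : ℝ) / N * P x y η) (fun y _ => hterm x y) hy
      _ ≤ _ := Finset.single_le_sum
          (f := fun x => ∑ y ∈ Finset.univ.erase x, (κ : ℝ) / N * P x y η)
          (fun x _ => Finset.sum_nonneg fun y _ => hterm x y) (Finset.mem_univ x)
  set D : ℝ := 1 + Real.log (N / t) with hD
  set M : ℝ := 2 + Real.log N with hM
  have hD0 : 0 ≤ D := by
    have := Real.log_nonneg ((one_le_div htpos).2 htN)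
    linarith
  have hM0 : 0 ≤ M := by
    have := Real.log_natCast_nonneg N
    linarith
  have hpair : ∀ x, ∀ y ∈ Finset.univ.erase x, ∑ η, P x y η ≤ D * M ^ (κ - 2) := by
    intro x y hy
    refine (sum_conf_prod_le N x (g y) (hg y)).trans ?_
    rw [← Finset.mul_prod_erase _ _ hy]
    refine mul_le_mul ?_ ?_
      (Finset.prod_nonneg fun z _ => Finset.sum_nonneg fun k _ => hg _ _ _) hD0
    · simpa [g] using sum_siteWeight_tail_le htpos htN
    · have hc : ((Finset.univ.erase x).erase y).card = κ - 2 := by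
        rw [Finset.card_erase_of_mem hy, Finset.card_erase_of_mem (Finset.mem_univ x),
          Finset.card_univ]
        omega
      rw [← hc]
      rw [← Finset.prod_const]
      refine Finset.prod_le_prod (fun z _ => Finset.sum_nonneg fun k _ => hg _ _ _) fun z hz => ?_
      simpa [g, Finset.ne_of_mem_erase hz] using sum_siteWeight_le hN
  calc _ ≤ ∑ η, ∑ x, ∑ y ∈ Finset.univ.erase x, (κ : ℝ) / N * P x y η :=
        Finset.sum_le_sum fun η _ => hpoint η
    _ = ∑ x, ∑ y ∈ Finset.univ.erase x, (κ : ℝ) / N * ∑ η, P x y η := by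
        rw [Finset.sum_comm]
        refine Finset.sum_congr rfl fun x _ => ?_
        rw [Finset.sum_comm]
        simp_rw [Finset.mul_sum]
    _ ≤ ∑ x : S, ∑ y ∈ Finset.univ.erase x, (κ : ℝ) / N * (D * M ^ (κ - 2)) :=
        Finset.sum_le_sum fun x _ => Finset.sum_le_sum fun y hy =>
          mul_le_mul_of_nonneg_left (hpair x y hy) (by positivity)
    _ ≤ ∑ x : S, ∑ y : S, (κ : ℝ) / N * (D * M ^ (κ - 2)) :=
        Finset.sum_le_sum fun x _ =>
          Finset.sum_le_sum_of_subset_of_nonneg (Finset.subset_univ _)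
            fun _ _ _ => by positivity
    _ = _ := by
        simp only [Finset.sum_const, Finset.card_univ, nsmul_eq_mul, ← hκdef]
        ring

/-- For every `a > 0` there is a constant `C = C(κ,a) > 0` such that, for all
sufficiently large `N`,
`(N/(log N)^{κ-1}) Σ_{η ∈ H_N(ℓ_N^{(a)})} 1/a(η) ≤ C (log log N)/(log N)`,
where `H_N(ℓ) = {η ∈ H_N : η_x ≤ N - ℓ for all x}` and `ℓ_N^{(a)} = N/(log N)^a`. -/
theorem truncated_partition_sum_bound
    (S : Type) [Fintype S] [DecidableEq S] (hcard : 2 ≤ Fintype.card S)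
    (a : ℝ) (ha : 0 < a) :
    ∃ C > (0:ℝ), ∃ N₀ : ℕ, ∀ N ≥ N₀,
      (N : ℝ) / Real.log N ^ (Fintype.card S - 1) *
        ∑ η : Conf S N,
          Set.indicator
            {η : Conf S N | ∀ x, (η.1 x : ℝ) ≤ (N : ℝ) - (N : ℝ) / Real.log N ^ a}
            (fun η => 1 / aconf η.1) η
      ≤ C * Real.log (Real.log N) / Real.log N := by
  have hκ : (1 : ℝ) ≤ Fintype.card S := by exact_mod_cast (by omega : 1 ≤ Fintype.card S)
  have hlogκ := Real.log_nonneg hκ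
  refine ⟨(Fintype.card S : ℝ) ^ 3 * (1 + Real.log (Fintype.card S) + a) *
    3 ^ (Fintype.card S - 2), by positivity, ⌈Real.exp (Real.exp 1)⌉₊, fun N hN => ?_⟩
  have hNe : Real.exp (Real.exp 1) ≤ N := Nat.ceil_le.1 hN
  have hNpos : (0 : ℝ) < N := (Real.exp_pos _).trans_le hNe
  have hN1 : 1 ≤ N := by exact_mod_cast hNpos
  have hL : Real.exp 1 ≤ Real.log N := (Real.le_log_iff_exp_le hNpos).2 hNe
  have hLpos : 0 < Real.log N := (Real.exp_pos _).trans_le hL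
  have hL1 : 1 ≤ Real.log N := (Real.one_le_exp zero_le_one).trans hL
  have hLL : 1 ≤ Real.log (Real.log N) := (Real.le_log_iff_exp_le hLpos).2 hL
  have hLa : 1 ≤ Real.log N ^ a := Real.one_le_rpow hL1 ha.le
  have hmain := sum_conf_indicator_le hcard hN1 (l := (N : ℝ) / Real.log N ^ a)
    (by positivity) (div_le_self hNpos.le hLa)
  have hlog : Real.log (N / ((N : ℝ) / Real.log N ^ a / Fintype.card S))
      = a * Real.log (Real.log N) + Real.log (Fintype.card S) := by
    have : (N : ℝ) / ((N : ℝ) / Real.log N ^ a / Fintype.card S)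
        = Real.log N ^ a * Fintype.card S := by
      field_simp
    rw [this, Real.log_mul (by positivity) (by positivity), Real.log_rpow hLpos]
  rw [hlog] at hmain
  have hbound : 1 + (a * Real.log (Real.log N) + Real.log (Fintype.card S))
      ≤ (1 + Real.log (Fintype.card S) + a) * Real.log (Real.log N) := by
    nlinarith
  have hpow : (2 + Real.log N) ^ (Fintype.card S - 2)
      ≤ 3 ^ (Fintype.card S - 2) * Real.log N ^ (Fintype.card S - 2) := by
    rw [← mul_pow]
    gcongr
    linarith
  have hm1 : Fintype.card S - 1 = Fintype.card S - 2 + 1 := by omega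
  calc _ ≤ (N : ℝ) / Real.log N ^ (Fintype.card S - 1) *
        ((Fintype.card S : ℝ) ^ 2 * ((Fintype.card S : ℝ) / N *
          (((1 + Real.log (Fintype.card S) + a) * Real.log (Real.log N)) *
            (3 ^ (Fintype.card S - 2) * Real.log N ^ (Fintype.card S - 2))))) := by
        refine mul_le_mul_of_nonneg_left (hmain.trans ?_) (by positivity)
        gcongr
    _ = _ := by
        rw [hm1, pow_succ]
        field_simp

end ZRP
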